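/- (Proposition 3, output-feedback PI-PBC.) Consider the converter ẋ = (J₀ + Σᵢ₌₁ᵐ Jᵢuᵢ − R)Qx + (G₀ + Σᵢ₌₁ᵐ Gᵢuᵢ)E with measured output y_m = Cx, admissible equilibrium (x*, u*), gains K_P = K_Pᵀ ≥ 0, K_I = K_Iᵀ > 0, and the closed-loop consisting of: (i) the FCT-GPEBO observer (ξ, Φ, Y, Ω, ω, θ̂) with parameters λ > 0, γ > 0, μ ∈ (0,1), Φ(0) = Iₙ, Y(0) = 0, Ω(0) = 0, ω(0) = 1, producing x̂ = ξ + Φθ̂_FCT with θ̂_FCT = (1/(1 − ω_c))[θ̂ − ω_c θ̂(0)], ω_c = min{ω, 1 − μ}; and (ii) the PI controller ẋ_c = G_N(x*)ᵀQ(x̂ − x*), u = −K_P G_N(x*)ᵀQ(x̂ − x*) − K_I x_c. Assume a differentiable solution of the full closed loop exists on [0,∞) and that Δ := det{Ω} satisfies ∫₀^{t_c} Δ(s)²ds ≥ −(1/γ)ln(1 − μ) for some t_c > 0. Then x and x_c are bounded on [0,∞) and lim_{t→∞} x(t) = x*. -/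

import Mathlib

open Matrix

attribute [local instance] Matrix.normedAddCommGroup Matrix.normedSpace

lemma aux_antitone {f f' : ℝ → ℝ} {T : ℝ} (hf : ∀ t ≥ T, HasDerivAt f (f' t) t)
    (h' : ∀ t ≥ T, f' t ≤ 0) {s t : ℝ} (hs : T ≤ s) (hst : s ≤ t) : f t ≤ f s := by
  have : AntitoneOn f (Set.Ici T) := by
    apply antitoneOn_of_hasDerivWithinAt_nonpos (convex_Ici T) (f' := f')
    · intro t ht
      exact (hf t ht).continuousAt.continuousWithinAt
    · intro t ht
      exact (hf t (interior_subset ht)).hasDerivWithinAt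
    · intro t ht
      exact h' t (interior_subset ht)
  exact this hs (le_trans hs hst) hst

lemma aux_zero {f a : ℝ → ℝ} (hf : ∀ t ≥ (0:ℝ), HasDerivAt f (-(a t) * f t) t)
    (ha : ∀ t, 0 ≤ a t) (h0 : f 0 = 0) : ∀ t ≥ (0:ℝ), f t = 0 := by
  intro t ht
  have h1 : ∀ t ≥ (0:ℝ), HasDerivAt (fun s => f s ^ 2) (-(2 * (a t * f t ^ 2))) t := by
    intro t ht
    refine ((hf t ht).pow 2).congr_deriv ?_
    simp only [Nat.cast_ofNat]; ring
  have := aux_antitone h1 (fun t _ => by have := ha t; have := sq_nonneg (f t); nlinarith [mul_nonneg (ha t) this])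
    le_rfl ht
  simp only [h0] at this
  nlinarith [sq_nonneg (f t)]

lemma aux_dot {k : ℕ} {a b : ℝ → Fin k → ℝ} {a' b' : Fin k → ℝ} {t : ℝ}
    (ha : HasDerivAt a a' t) (hb : HasDerivAt b b' t) :
    HasDerivAt (fun s => a s ⬝ᵥ b s) (a' ⬝ᵥ b t + a t ⬝ᵥ b') t := by
  rw [hasDerivAt_pi] at ha hb
  simp only [dotProduct, ← Finset.sum_add_distrib]
  exact HasDerivAt.fun_sum fun i _ => (ha i).mul (hb i)

lemma aux_mulVec {k l : ℕ} (P : Matrix (Fin l) (Fin k) ℝ) {a : ℝ → Fin k → ℝ} {a' : Fin k → ℝ} {t : ℝ}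
    (ha : HasDerivAt a a' t) :
    HasDerivAt (fun s => P *ᵥ a s) (P *ᵥ a') t := by
  exact (LinearMap.toContinuousLinearMap P.mulVecLin).hasFDerivAt.comp_hasDerivAt t ha

lemma aux_mulVec' {k l : ℕ} {P : ℝ → Matrix (Fin l) (Fin k) ℝ} {P' : Matrix (Fin l) (Fin k) ℝ}
    {t : ℝ} (v : Fin k → ℝ)
    (ha : HasDerivAt P P' t) :
    HasDerivAt (fun s => P s *ᵥ v) (P' *ᵥ v) t := by
  exact (LinearMap.toContinuousLinearMap
    ((Matrix.mulVecBilin ℝ ℝ).flip v : Matrix (Fin l) (Fin k) ℝ →ₗ[ℝ] (Fin l → ℝ))).hasFDerivAt.comp_hasDerivAt t ha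

lemma aux_sym {k : ℕ} {P : Matrix (Fin k) (Fin k) ℝ} (hP : P.IsHermitian) (v w : Fin k → ℝ) :
    v ⬝ᵥ P *ᵥ w = w ⬝ᵥ P *ᵥ v := by
  have h : Pᵀ = P := by simpa [Matrix.IsHermitian] using hP
  rw [dotProduct_mulVec, ← mulVec_transpose, h, dotProduct_comm]

lemma aux_skew {k : ℕ} {P : Matrix (Fin k) (Fin k) ℝ} (hP : Pᵀ = -P) (v : Fin k → ℝ) :
    v ⬝ᵥ P *ᵥ v = 0 := by
  have : v ⬝ᵥ P *ᵥ v = - (v ⬝ᵥ P *ᵥ v) := by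
    conv_lhs => rw [dotProduct_mulVec, ← mulVec_transpose, hP, dotProduct_comm, neg_mulVec, dotProduct_neg]
  linarith

lemma aux_quad {k : ℕ} {P : Matrix (Fin k) (Fin k) ℝ} (hP : P.IsHermitian) {a : ℝ → Fin k → ℝ}
    {a' : Fin k → ℝ} {t : ℝ} (ha : HasDerivAt a a' t) :
    HasDerivAt (fun s => a s ⬝ᵥ P *ᵥ a s) (2 * ((P *ᵥ a t) ⬝ᵥ a')) t := by
  convert aux_dot ha (aux_mulVec P ha) using 1
  rw [aux_sym hP (a t) a', dotProduct_comm (P *ᵥ a t)]; ring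

lemma aux_coercive {k : ℕ} {P : Matrix (Fin k) (Fin k) ℝ} (hP : P.PosDef) :
    ∃ c > 0, ∀ z : Fin k → ℝ, c * ‖z‖ ^ 2 ≤ z ⬝ᵥ P *ᵥ z := by
  have hcont : Continuous fun z : Fin k → ℝ => z ⬝ᵥ P *ᵥ z := by fun_prop
  have hpos : ∀ z : Fin k → ℝ, z ≠ 0 → 0 < z ⬝ᵥ P *ᵥ z := fun z hz => by
    simpa using hP.dotProduct_mulVec_pos hz
  obtain hs | hs := (Metric.sphere (0 : Fin k → ℝ) 1).eq_empty_or_nonempty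
  · refine ⟨1, one_pos, fun z => ?_⟩
    have : z = 0 := by
      by_contra hz
      have : ‖z‖⁻¹ • z ∈ Metric.sphere (0 : Fin k → ℝ) 1 := by
        simp [norm_smul, hz]
      simp [hs] at this
    simp [this]
  · obtain ⟨w, hw, hmin⟩ := (isCompact_sphere (0 : Fin k → ℝ) 1).exists_isMinOn hs hcont.continuousOn
    refine ⟨w ⬝ᵥ P *ᵥ w, hpos w ?_, fun z => ?_⟩
    · rintro rfl; simp at hw
    · by_cases hz : z = 0
      · simp [hz]
      have hz' : ‖z‖ ≠ 0 := by simpa using hz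
      have h1 : ‖z‖⁻¹ • z ∈ Metric.sphere (0 : Fin k → ℝ) 1 := by
        simp [norm_smul, hz]
      have h2 := hmin h1
      simp only [Set.mem_ofPred_eq, mulVec_smul, dotProduct_smul, smul_dotProduct, smul_eq_mul] at h2
      have h3 : z ⬝ᵥ P *ᵥ z = ‖z‖ ^ 2 * (‖z‖⁻¹ * (‖z‖⁻¹ * z ⬝ᵥ P *ᵥ z)) := by
        field_simp
      rw [h3, mul_comm]
      gcongr

lemma aux_barbalat {W W' f f' : ℝ → ℝ} {T K : ℝ} (hW : ∀ t ≥ T, HasDerivAt W (W' t) t)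
    (hW0 : ∀ t ≥ T, 0 ≤ W t) (hf : ∀ t ≥ T, HasDerivAt f (f' t) t)
    (hWf : ∀ t ≥ T, W' t ≤ - f t) (hf0 : ∀ t ≥ T, 0 ≤ f t) (hK : ∀ t ≥ T, |f' t| ≤ K) :
    Filter.Tendsto f Filter.atTop (nhds 0) := by
  have hanti : ∀ s t, T ≤ s → s ≤ t → W t ≤ W s := fun s t hs hst =>
    aux_antitone hW (fun t ht => by linarith [hWf t ht, hf0 t ht]) hs hst
  have hKnn : 0 ≤ K := (abs_nonneg _).trans (hK T le_rfl)
  have hlow : ∀ t ≥ T, ∀ s ≥ t, f t - K * (s - t) ≤ f s := by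
    intro t ht s hs
    have h1 : ∀ r ≥ t, HasDerivAt (fun r => f t - K * (r - t) - f r) (-K - f' r) r := by
      intro r hr
      have := ((((hasDerivAt_id r).sub_const t).const_mul K).const_sub (f t)).sub
        (hf r (ht.le.trans hr))
      refine this.congr_deriv ?_
      simp
    have := aux_antitone h1 (fun r hr => by
      have := neg_abs_le (f' r); have := hK r (ht.le.trans hr); linarith) le_rfl hs
    simp at this
    linarith
  have key : ∀ t ≥ T, ∀ d ≥ 0, W (t + d) ≤ W t - f t * d + K * d ^ 2 / 2 := by
    intro t ht d hd
    have h1 : ∀ r ≥ t, HasDerivAt (fun r => W r + f t * (r - t) - K / 2 * (r - t) ^ 2)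
        (W' r + f t - K * (r - t)) r := by
      intro r hr
      have h := ((hW r (ht.le.trans hr)).add (((hasDerivAt_id r).sub_const t).const_mul (f t))).sub
        ((((hasDerivAt_id r).sub_const t).pow 2).const_mul (K / 2))
      refine h.congr_deriv ?_
      simp; ring
    have := aux_antitone h1 (fun r hr => by
      have := hlow t ht r hr; have := hWf r (ht.le.trans hr); linarith) le_rfl
      (show t ≤ t + d by linarith)
    simp at this
    linarith
  -- convergence of W along max
  have hlim : ∃ L, Filter.Tendsto (fun t => W (max t T)) Filter.atTop (nhds L) := by
    refine ⟨_, tendsto_atTop_ciInf (f := fun t => W (max t T)) ?_ ?_⟩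
    · intro s t hst
      exact hanti _ _ (le_max_right _ _) (max_le_max hst le_rfl)
    · refine ⟨0, ?_⟩
      rintro _ ⟨t, rfl⟩
      exact hW0 _ (le_max_right _ _)
  obtain ⟨L, hL⟩ := hlim
  rw [Metric.tendsto_atTop]
  intro ε hε
  set d := ε / (K + 1) with hd
  have hdpos : 0 < d := by positivity
  have hdK : K * d ≤ ε := by
    rw [hd, mul_div_assoc', div_le_iff₀ (by linarith)]
    nlinarith
  have hdiff : Filter.Tendsto (fun t => W (max t T) - W (max (t + d) T)) Filter.atTop (nhds 0) := by
    have := hL.sub (hL.comp (Filter.tendsto_atTop_add_const_right _ d Filter.tendsto_id))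
    simpa using this
  have hev := hdiff.eventually (gt_mem_nhds (show (0:ℝ) < ε / 2 * d by positivity))
  obtain ⟨N, hN⟩ := Filter.eventually_atTop.1 hev
  refine ⟨max N T, fun t ht => ?_⟩
  have htT : T ≤ t := (le_max_right _ _).trans ht
  have h1 := hN t ((le_max_left _ _).trans ht)
  rw [max_eq_left htT, max_eq_left (by linarith)] at h1
  have h2 := key t htT d hdpos.le
  rw [Real.dist_eq, sub_zero, abs_of_nonneg (hf0 t htT)]
  have h3 : f t * d < ε * d := by nlinarith
  exact lt_of_mul_lt_mul_right h3 hdpos.le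

/-- the scalar filter `ω` falls below `1 - μ` after the excitation interval -/
lemma aux_omega {γ μ tc : ℝ} (hγ : 0 < γ) (hμ : μ ∈ Set.Ioo (0:ℝ) 1) (htc : 0 < tc)
    {Δ ω : ℝ → ℝ} (hc : ∀ t ≥ (0:ℝ), ContinuousAt Δ t)
    (hω : ∀ t ≥ (0:ℝ), HasDerivAt ω (-(γ * (Δ t) ^ 2) * ω t) t) (hω0 : ω 0 = 1)
    (hexc : -(1 / γ) * Real.log (1 - μ) ≤ ∫ s in (0:ℝ)..tc, (Δ s) ^ 2) :
    ∀ t ≥ tc, ω t ≤ 1 - μ := by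
  set D : ℝ → ℝ := fun t => Δ (max t 0) with hD
  have hDc : Continuous D := by
    rw [continuous_iff_continuousAt]
    intro t
    exact ContinuousAt.comp (f := fun t : ℝ => max t 0) (hc _ (le_max_right _ _)) (by fun_prop)
  have hD0 : ∀ t ≥ (0:ℝ), D t = Δ t := fun t ht => by simp [hD, max_eq_left ht]
  set F : ℝ → ℝ := fun t => ∫ s in (0:ℝ)..t, (D s) ^ 2 with hF
  have hFd : ∀ t, HasDerivAt F (D t ^ 2) t := fun t =>
    intervalIntegral.integral_hasDerivAt_right ((hDc.pow 2).intervalIntegrable _ _)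
      ((hDc.pow 2).stronglyMeasurableAtFilter _ _) (hDc.pow 2).continuousAt
  have hz : ∀ t ≥ (0:ℝ), ω t - Real.exp (-γ * F t) = 0 := by
    apply aux_zero (a := fun t => γ * Δ t ^ 2)
    · intro t ht
      have h := (hω t ht).sub ((hFd t).const_mul (-γ)).exp
      refine h.congr_deriv ?_
      rw [hD0 t ht]; ring
    · intro t; positivity
    · simp [hF, hω0]
  have h1 : ω tc ≤ 1 - μ := by
    have : F tc = ∫ s in (0:ℝ)..tc, (Δ s) ^ 2 := by
      apply intervalIntegral.integral_congr
      intro s hs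
      rw [Set.uIcc_of_le htc.le] at hs
      simp only [hD0 s hs.1]
    rw [← this] at hexc
    have h2 : ω tc = Real.exp (-γ * F tc) := by linarith [hz tc htc.le]
    have hμ' : 0 < 1 - μ := by linarith [hμ.2]
    rw [h2, ← Real.exp_log hμ', Real.exp_le_exp]
    have := mul_le_mul_of_nonneg_left hexc hγ.le
    have h3 : γ * (-(1 / γ) * Real.log (1 - μ)) = - Real.log (1 - μ) := by field_simp
    rw [h3] at this
    linarith
  intro t ht
  have := aux_antitone (T := tc) (fun t ht => hω t (htc.le.trans ht)) (fun t ht => by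
    have : 0 ≤ ω t := by
      have := hz t (htc.le.trans ht); have := Real.exp_pos (-γ * F t); linarith
    have := mul_nonneg (mul_nonneg hγ.le (sq_nonneg (Δ t))) this
    linarith) le_rfl ht
  linarith

/-- Proposition 3, output-feedback PI-PBC. The converter in closed loop
with the PI-PBC driven by the FCT-GPEBO state estimate `x̂`, under the interval-excitation
assumption on `Δ = det{Ω}`, has bounded trajectories `x`, `x_c` and `x(t) → x*`. -/
theorem output_feedback_pi_pbc {n m p : ℕ}
    (J₀ : Matrix (Fin n) (Fin n) ℝ) (J : Fin m → Matrix (Fin n) (Fin n) ℝ)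
    (R Q G₀ : Matrix (Fin n) (Fin n) ℝ) (G : Fin m → Matrix (Fin n) (Fin n) ℝ)
    (E : Fin n → ℝ) (xs : Fin n → ℝ) (us : Fin m → ℝ)
    (hJ₀ : J₀ᵀ = -J₀) (hJ : ∀ i, (J i)ᵀ = -(J i))
    (hR : R.PosDef) (hQ : Q.PosDef) (hQdiag : Q.IsDiag)
    -- admissible equilibrium
    (heq : 0 = (J₀ + ∑ i, us i • J i - R).mulVec (Q.mulVec xs)
            + (G₀ + ∑ i, us i • G i).mulVec E)
    -- Λ(u) = (J₀ + Σ Jᵢuᵢ − R)Q and G_N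
    (Λ : (Fin m → ℝ) → Matrix (Fin n) (Fin n) ℝ)
    (hΛ : ∀ v, Λ v = (J₀ + ∑ i, v i • J i - R) * Q)
    (GN : (Fin n → ℝ) → Matrix (Fin n) (Fin m) ℝ)
    (hGN : ∀ z, GN z = Matrix.of fun k i => ((J i).mulVec (Q.mulVec z) + (G i).mulVec E) k)
    -- PI gains
    (KP KI : Matrix (Fin m) (Fin m) ℝ) (hKP : KP.PosSemidef) (hKI : KI.PosDef)
    -- plant with measured output
    (x : ℝ → Fin n → ℝ) (u : ℝ → Fin m → ℝ)
    (C : Matrix (Fin p) (Fin n) ℝ)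
    (ym : ℝ → Fin p → ℝ) (hym : ∀ t, ym t = C.mulVec (x t))
    (hx : ∀ t ≥ (0:ℝ), HasDerivAt x
      ((Λ (u t)).mulVec (x t) + (G₀ + ∑ i, u t i • G i).mulVec E) t)
    -- observer tuning parameters
    (lam γ μ : ℝ) (hlam : 0 < lam) (hγ : 0 < γ) (hμ : μ ∈ Set.Ioo (0:ℝ) 1)
    -- FCT-GPEBO observer states and dynamics
    (ξ : ℝ → Fin n → ℝ) (Φ Ω : ℝ → Matrix (Fin n) (Fin n) ℝ)
    (Y : ℝ → Fin n → ℝ) (ω : ℝ → ℝ) (θh : ℝ → Fin n → ℝ)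
    (Δ : ℝ → ℝ) (hΔ : ∀ t, Δ t = (Ω t).det)
    (Ycal : ℝ → Fin n → ℝ) (hYcal : ∀ t, Ycal t = (Ω t).adjugate.mulVec (Y t))
    (hξ : ∀ t ≥ (0:ℝ), HasDerivAt ξ
      ((Λ (u t)).mulVec (ξ t) + (G₀ + ∑ i, u t i • G i).mulVec E) t)
    (hΦ : ∀ t ≥ (0:ℝ), HasDerivAt Φ (Λ (u t) * Φ t) t) (hΦ0 : Φ 0 = 1)
    (hY : ∀ t ≥ (0:ℝ), HasDerivAt Y
      (-(lam • Y t) + lam • ((Φ t)ᵀ * Cᵀ).mulVec (ym t - C.mulVec (ξ t))) t)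
    (hY0 : Y 0 = 0)
    (hΩ : ∀ t ≥ (0:ℝ), HasDerivAt Ω
      (-(lam • Ω t) + lam • ((Φ t)ᵀ * Cᵀ * C * Φ t)) t)
    (hΩ0 : Ω 0 = 0)
    (hω : ∀ t ≥ (0:ℝ), HasDerivAt ω (-(γ * (Δ t) ^ 2) * ω t) t) (hω0 : ω 0 = 1)
    (hθh : ∀ t ≥ (0:ℝ), HasDerivAt θh ((γ * Δ t) • (Ycal t - Δ t • θh t)) t)
    -- FCT state estimate
    (ωc : ℝ → ℝ) (hωc : ∀ t, ωc t = min (ω t) (1 - μ))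
    (θFCT : ℝ → Fin n → ℝ)
    (hθFCT : ∀ t, θFCT t = (1 - ωc t)⁻¹ • (θh t - ωc t • θh 0))
    (xh : ℝ → Fin n → ℝ) (hxh : ∀ t, xh t = ξ t + (Φ t).mulVec (θFCT t))
    -- PI-PBC fed with the estimated state
    (xc : ℝ → Fin m → ℝ)
    (hxc : ∀ t ≥ (0:ℝ), HasDerivAt xc ((GN xs)ᵀ.mulVec (Q.mulVec (xh t - xs))) t)
    (hu : ∀ t ≥ (0:ℝ), u t = -KP.mulVec ((GN xs)ᵀ.mulVec (Q.mulVec (xh t - xs)))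
                              - KI.mulVec (xc t))
    -- sufficient interval excitation (Assumption 1)
    (tc : ℝ) (htc : 0 < tc)
    (hexc : -(1 / γ) * Real.log (1 - μ) ≤ ∫ s in (0:ℝ)..tc, (Δ s) ^ 2) :
    (∃ M : ℝ, ∀ t ≥ (0:ℝ), ‖x t‖ ≤ M ∧ ‖xc t‖ ≤ M)
    ∧ Filter.Tendsto x Filter.atTop (nhds xs) := by
  -- dissipation identity
  have hΛv : ∀ v z, Λ v *ᵥ z = (J₀ + ∑ i, v i • J i) *ᵥ (Q *ᵥ z) - R *ᵥ (Q *ᵥ z) := by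
    intro v z
    rw [hΛ, ← mulVec_mulVec, sub_mulVec]
  have hskew : ∀ v : Fin m → ℝ, (J₀ + ∑ i, v i • J i)ᵀ = -(J₀ + ∑ i, v i • J i) := by
    intro v
    simp only [transpose_add, transpose_sum, transpose_smul, hJ₀, hJ, smul_neg,
      Finset.sum_neg_distrib, neg_add]
  have hdiss : ∀ v z, (Q *ᵥ z) ⬝ᵥ (Λ v *ᵥ z) = -((Q *ᵥ z) ⬝ᵥ R *ᵥ (Q *ᵥ z)) := by
    intro v z
    rw [hΛv, dotProduct_sub, aux_skew (hskew v)]; ring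
  have hRnn : ∀ z : Fin n → ℝ, 0 ≤ z ⬝ᵥ R *ᵥ z := fun z => by
    simpa using hR.posSemidef.dotProduct_mulVec_nonneg z
  have hKPnn : ∀ z : Fin m → ℝ, 0 ≤ z ⬝ᵥ KP *ᵥ z := fun z => by
    simpa using hKP.dotProduct_mulVec_nonneg z
  obtain ⟨cQ, hcQ, hQc⟩ := aux_coercive hQ
  obtain ⟨cI, hcI, hIc⟩ := aux_coercive hKI
  -- step 1: x = ξ + Φ θ
  obtain ⟨θ, hθ⟩ : ∃ θ, θ = x 0 - ξ 0 := ⟨_, rfl⟩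
  have hxΦ : ∀ t ≥ (0:ℝ), x t = ξ t + Φ t *ᵥ θ := by
    have hed : ∀ t ≥ (0:ℝ), HasDerivAt (fun s => x s - ξ s - Φ s *ᵥ θ)
        (Λ (u t) *ᵥ (x t - ξ t - Φ t *ᵥ θ)) t := by
      intro t ht
      refine (((hx t ht).sub (hξ t ht)).sub (aux_mulVec' θ (hΦ t ht))).congr_deriv ?_
      rw [mulVec_sub, mulVec_sub, ← mulVec_mulVec]
      abel
    intro t ht
    have h1 := aux_antitone (T := 0) (fun t ht => aux_quad hQ.isHermitian (hed t ht))
      (fun t ht => by rw [hdiss]; linarith [hRnn (Q *ᵥ (x t - ξ t - Φ t *ᵥ θ))]) le_rfl ht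
    have h0 : x 0 - ξ 0 - Φ 0 *ᵥ θ = 0 := by rw [hΦ0, one_mulVec, hθ, sub_self]
    simp only [h0, zero_dotProduct] at h1
    have h2 := (hQc _).trans h1
    have h3 : ‖x t - ξ t - Φ t *ᵥ θ‖ = 0 := by
      have := norm_nonneg (x t - ξ t - Φ t *ᵥ θ)
      by_contra hne
      have : 0 < ‖x t - ξ t - Φ t *ᵥ θ‖ := lt_of_le_of_ne this (Ne.symm hne)
      have : 0 < cQ * ‖x t - ξ t - Φ t *ᵥ θ‖ ^ 2 := by positivity
      linarith
    rw [norm_eq_zero, sub_sub, sub_eq_zero] at h3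
    exact h3
  -- step 2: Y = Ω θ
  have hYΩ : ∀ t ≥ (0:ℝ), Y t = Ω t *ᵥ θ := by
    have hd : ∀ t ≥ (0:ℝ), HasDerivAt (fun s => Y s - Ω s *ᵥ θ)
        (-lam • (Y t - Ω t *ᵥ θ)) t := by
      intro t ht
      refine ((hY t ht).sub (aux_mulVec' θ (hΩ t ht))).congr_deriv ?_
      have : ym t - C *ᵥ ξ t = C *ᵥ (Φ t *ᵥ θ) := by
        rw [hym, hxΦ t ht, mulVec_add]; abel
      rw [this, add_mulVec, neg_mulVec, smul_mulVec, smul_mulVec, mulVec_mulVec, mulVec_mulVec,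
        smul_sub, neg_smul, neg_smul]
      abel
    intro t ht
    ext i
    have := aux_zero (f := fun s => Y s i - (Ω s *ᵥ θ) i) (a := fun _ => lam)
      (fun t ht => (hasDerivAt_pi.1 (hd t ht) i)) (fun _ => hlam.le) (by simp [hY0, hΩ0]) t ht
    linarith
  -- step 3: θh - θ = ω (θh 0 - θ)
  have hYc : ∀ t ≥ (0:ℝ), Ycal t = Δ t • θ := by
    intro t ht
    rw [hYcal, hYΩ t ht, mulVec_mulVec, adjugate_mul, smul_mulVec, one_mulVec, hΔ]
  have hθω : ∀ t ≥ (0:ℝ), θh t - θ = ω t • (θh 0 - θ) := by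
    intro t ht
    ext i
    have := aux_zero (f := fun s => θh s i - θ i - ω s * (θh 0 i - θ i))
      (a := fun s => γ * Δ s ^ 2)
      (fun t ht => by
        refine (((hasDerivAt_pi.1 (hθh t ht) i).sub_const (θ i)).sub
          ((hω t ht).mul_const (θh 0 i - θ i))).congr_deriv ?_
        simp only [hYc t ht, Pi.smul_apply, Pi.sub_apply, smul_eq_mul]
        ring)
      (fun _ => by positivity) (by simp [hω0]) t ht
    simp only [Pi.sub_apply, Pi.smul_apply, smul_eq_mul]
    linarith
  have hΔc : ∀ t ≥ (0:ℝ), ContinuousAt Δ t := by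
    intro t ht
    have h1 : Δ = fun s => (Ω s).det := funext hΔ
    rw [h1]
    exact ContinuousAt.comp (g := fun M : Matrix (Fin n) (Fin n) ℝ => M.det)
      (Continuous.matrix_det continuous_id).continuousAt (hΩ t ht).continuousAt
  have hωle := aux_omega hγ hμ htc hΔc hω hω0 hexc
  -- step 4: the estimate is exact after tc
  have hxhx : ∀ t ≥ tc, xh t = x t := by
    intro t ht
    have ht0 : 0 ≤ t := htc.le.trans ht
    have h1 : ωc t = ω t := by rw [hωc, min_eq_left (hωle t ht)]
    have h2 : 1 - ω t ≠ 0 := by have := hωle t ht; have := hμ.1; intro h; linarith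
    have h3 : θFCT t = θ := by
      rw [hθFCT, h1]
      have : θh t - ω t • θh 0 = (1 - ω t) • θ := by
        have h := hθω t ht0
        rw [smul_sub, sub_eq_iff_eq_add] at h
        rw [h, sub_smul, one_smul]; abel
      rw [this, smul_smul, inv_mul_cancel₀ h2, one_smul]
    rw [hxh, h3, hxΦ t ht0]
  -- step 5: Lyapunov function
  obtain ⟨B, hB⟩ : ∃ B, B = GN xs := ⟨_, rfl⟩
  rw [← hB] at hxc hu
  obtain ⟨xcs, hxcs⟩ : ∃ xcs : Fin m → ℝ, KI *ᵥ xcs = -us := by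
    refine ⟨KI⁻¹ *ᵥ (-us), ?_⟩
    rw [mulVec_mulVec, mul_nonsing_inv _ ((isUnit_iff_isUnit_det _).1 hKI.isUnit), one_mulVec]
  have hBv : ∀ v : Fin m → ℝ, B *ᵥ v = (∑ i, v i • J i) *ᵥ (Q *ᵥ xs) + (∑ i, v i • G i) *ᵥ E := by
    intro v
    ext k
    rw [hB, hGN]
    simp only [mulVec, dotProduct, of_apply, Pi.add_apply, Matrix.sum_apply, Matrix.smul_apply,
      smul_eq_mul, Finset.sum_mul, add_mul, Finset.sum_add_distrib]
    congr 1
    · rw [Finset.sum_comm]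
      exact Finset.sum_congr rfl fun i _ => Finset.sum_congr rfl fun j _ => by ring
    · rw [Finset.sum_comm]
      exact Finset.sum_congr rfl fun i _ => Finset.sum_congr rfl fun j _ => by ring
  have herr : ∀ (z : Fin n → ℝ) (v : Fin m → ℝ),
      Λ v *ᵥ z + (G₀ + ∑ i, v i • G i) *ᵥ E = Λ v *ᵥ (z - xs) + B *ᵥ (v - us) := by
    intro z v
    have h1 : Λ v *ᵥ z + (G₀ + ∑ i, v i • G i) *ᵥ E = Λ v *ᵥ z + (G₀ + ∑ i, v i • G i) *ᵥ E
      - ((J₀ + ∑ i, us i • J i - R) *ᵥ (Q *ᵥ xs) + (G₀ + ∑ i, us i • G i) *ᵥ E) := by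
      rw [← heq, sub_zero]
    rw [h1, mulVec_sub (Λ v), mulVec_sub B, hBv, hBv, hΛv v xs]
    simp only [add_mulVec, sub_mulVec]
    abel
  have hxt : ∀ t ≥ (0:ℝ), HasDerivAt (fun s => x s - xs)
      (Λ (u t) *ᵥ (x t - xs) + B *ᵥ (u t - us)) t := by
    intro t ht
    exact ((hx t ht).sub_const xs).congr_deriv (herr _ _)
  have hut : ∀ t ≥ tc, u t - us = -(KP *ᵥ (Bᵀ *ᵥ (Q *ᵥ (x t - xs)))) - KI *ᵥ (xc t - xcs) := by
    intro t ht
    rw [hu t (htc.le.trans ht), hxhx t ht, mulVec_sub KI, hxcs]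
    abel
  obtain ⟨W, hWdef⟩ : ∃ W : ℝ → ℝ, W = fun t =>
    ((x t - xs) ⬝ᵥ Q *ᵥ (x t - xs) + (xc t - xcs) ⬝ᵥ KI *ᵥ (xc t - xcs)) / 2 := ⟨_, rfl⟩
  obtain ⟨P, hP⟩ : ∃ P, P = Q * R * Q := ⟨_, rfl⟩
  have hQT : Qᵀ = Q := by simpa [Matrix.IsHermitian] using hQ.isHermitian
  have hPpd : P.PosDef := by
    have := hR.conjTranspose_mul_mul_same (B := Q)
      (mulVec_injective_of_isUnit hQ.isUnit)
    simpa [hP, hQT] using this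
  have hPq : ∀ z : Fin n → ℝ, z ⬝ᵥ P *ᵥ z = (Q *ᵥ z) ⬝ᵥ R *ᵥ (Q *ᵥ z) := by
    intro z
    rw [hP, ← mulVec_mulVec, ← mulVec_mulVec, dotProduct_mulVec, ← mulVec_transpose, hQT]
  have hWd : ∀ t ≥ tc, HasDerivAt W (-((x t - xs) ⬝ᵥ P *ᵥ (x t - xs))
      - (Bᵀ *ᵥ (Q *ᵥ (x t - xs))) ⬝ᵥ KP *ᵥ (Bᵀ *ᵥ (Q *ᵥ (x t - xs)))) t := by
    intro t ht
    have ht0 : 0 ≤ t := htc.le.trans ht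
    rw [hWdef]
    refine (((aux_quad hQ.isHermitian (hxt t ht0)).add
      (aux_quad hKI.isHermitian ((hxc t ht0).sub_const xcs))).div_const 2).congr_deriv ?_
    rw [dotProduct_add, hdiss, hPq, hxhx t ht, hut t ht]
    have h1 : ∀ w : Fin m → ℝ, (Q *ᵥ (x t - xs)) ⬝ᵥ B *ᵥ w = (Bᵀ *ᵥ (Q *ᵥ (x t - xs))) ⬝ᵥ w := by
      intro w
      rw [dotProduct_mulVec, mulVec_transpose]
    rw [h1, dotProduct_sub, dotProduct_neg,
      dotProduct_comm (KI *ᵥ (xc t - xcs)) (Bᵀ *ᵥ (Q *ᵥ (x t - xs)))]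
    ring
  have hPnn : ∀ z : Fin n → ℝ, 0 ≤ z ⬝ᵥ P *ᵥ z := fun z => by rw [hPq]; exact hRnn _
  have hWge : ∀ t, cQ * ‖x t - xs‖ ^ 2 + cI * ‖xc t - xcs‖ ^ 2 ≤ 2 * W t := by
    intro t
    have := hQc (x t - xs); have := hIc (xc t - xcs)
    rw [hWdef]; simp only; linarith
  have hWnn : ∀ t, 0 ≤ W t := by
    intro t
    have h1 := hWge t
    have : 0 ≤ cQ * ‖x t - xs‖ ^ 2 + cI * ‖xc t - xcs‖ ^ 2 := by positivity
    linarith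
  have hWle : ∀ t ≥ tc, W t ≤ W tc := fun t ht =>
    aux_antitone hWd (fun t ht => by
      linarith [hPnn (x t - xs), hKPnn (Bᵀ *ᵥ (Q *ᵥ (x t - xs)))]) le_rfl ht
  -- boundedness of (x, xc)
  have hsq : ∀ (a c w : ℝ), 0 < c → c * a ^ 2 ≤ w → a ≤ w / c + 1 := by
    intro a c w hc h
    have : a ^ 2 ≤ w / c := by rw [le_div_iff₀ hc]; linarith
    nlinarith [sq_nonneg (a - 1)]
  have hbd : ∃ M : ℝ, ∀ t ≥ (0:ℝ), ‖x t‖ ≤ M ∧ ‖xc t‖ ≤ M := by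
    obtain ⟨M1, hM1⟩ := (isCompact_Icc (a := (0:ℝ)) (b := tc)).exists_bound_of_continuousOn
      (f := x) fun t ht => (hx t ht.1).continuousAt.continuousWithinAt
    obtain ⟨M2, hM2⟩ := (isCompact_Icc (a := (0:ℝ)) (b := tc)).exists_bound_of_continuousOn
      (f := xc) fun t ht => (hxc t ht.1).continuousAt.continuousWithinAt
    refine ⟨max (max M1 M2) (max (2 * W tc / cQ + 1 + ‖xs‖) (2 * W tc / cI + 1 + ‖xcs‖)),
      fun t ht => ?_⟩
    rcases le_total t tc with h | h
    · have h1 := hM1 t ⟨ht, h⟩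
      have h2 := hM2 t ⟨ht, h⟩
      exact ⟨h1.trans (by simp), h2.trans (by simp)⟩
    · have h1 := hWge t
      have h2 := hWle t h
      have h3 : 0 ≤ cQ * ‖x t - xs‖ ^ 2 := by positivity
      have h4 : 0 ≤ cI * ‖xc t - xcs‖ ^ 2 := by positivity
      have h5 := hsq ‖x t - xs‖ cQ (2 * W tc) hcQ (by linarith)
      have h6 := hsq ‖xc t - xcs‖ cI (2 * W tc) hcI (by linarith)
      have h7 : ‖x t‖ ≤ ‖x t - xs‖ + ‖xs‖ := by simpa using norm_add_le (x t - xs) xs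
      have h8 : ‖xc t‖ ≤ ‖xc t - xcs‖ + ‖xcs‖ := by simpa using norm_add_le (xc t - xcs) xcs
      refine ⟨le_trans ?_ ((le_max_left _ _).trans (le_max_right _ _)),
        le_trans ?_ ((le_max_right _ _).trans (le_max_right _ _))⟩ <;> linarith
  refine ⟨hbd, ?_⟩
  -- convergence
  obtain ⟨M, hM⟩ := hbd
  obtain ⟨H, hH⟩ : ∃ H : (Fin n → ℝ) × (Fin m → ℝ) → ℝ, H = fun q =>
    2 * ((P *ᵥ (q.1 - xs)) ⬝ᵥ (Λ (us + (-(KP *ᵥ (Bᵀ *ᵥ (Q *ᵥ (q.1 - xs)))) - KI *ᵥ (q.2 - xcs)))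
      *ᵥ (q.1 - xs)
      + B *ᵥ (-(KP *ᵥ (Bᵀ *ᵥ (Q *ᵥ (q.1 - xs)))) - KI *ᵥ (q.2 - xcs)))) := ⟨_, rfl⟩
  have hΛc : Continuous Λ := by
    have : Λ = fun v => (J₀ + ∑ i, v i • J i - R) * Q := funext hΛ
    rw [this]
    fun_prop
  have hHc : Continuous H := by
    rw [hH]
    fun_prop
  obtain ⟨K, hK⟩ := (isCompact_closedBall (0 : (Fin n → ℝ) × (Fin m → ℝ)) M).exists_bound_of_continuousOn
    hHc.continuousOn
  have hlim := aux_barbalat (T := tc) (K := K) hWd (fun t _ => hWnn t)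
    (f := fun t => (x t - xs) ⬝ᵥ P *ᵥ (x t - xs)) (f' := fun t => H (x t, xc t))
    (fun t ht => by
      refine (aux_quad hPpd.isHermitian (hxt t (htc.le.trans ht))).congr_deriv ?_
      rw [hH]
      simp only
      rw [← hut t ht]
      simp)
    (fun t ht => by linarith [hKPnn (Bᵀ *ᵥ (Q *ᵥ (x t - xs)))])
    (fun t _ => hPnn _)
    (fun t ht => by
      have h := hM t (htc.le.trans ht)
      have := hK (x t, xc t) (by simpa [Prod.norm_def] using h)
      simpa using this)
  obtain ⟨c, hc, hPc⟩ := aux_coercive hPpd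
  rw [tendsto_iff_norm_sub_tendsto_zero]
  have hsqlim : Filter.Tendsto (fun t => ‖x t - xs‖ ^ 2) Filter.atTop (nhds 0) := by
    have h1 : Filter.Tendsto (fun t => c⁻¹ * ((x t - xs) ⬝ᵥ P *ᵥ (x t - xs))) Filter.atTop
        (nhds 0) := by simpa using hlim.const_mul c⁻¹
    refine squeeze_zero (fun t => by positivity) (fun t => ?_) h1
    rw [← div_eq_inv_mul, le_div_iff₀ hc]
    linarith [hPc (x t - xs)]
  have := hsqlim.sqrt
  simpa using this
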